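/- Fix G > 0 and C₁ > 0. There exist constants α₀ > 0 and C = C(G, C₁) > 0 such that the following holds for all α ∈ (0, α₀], all s ∈ (5/6, 1), all integers K ≥ 2, all g ∈ (0, G], and all E ∈ [−G, G], with t = g/(K log K) and Δ = t²/α, provided Δ ≤ 1: for every probability density q on ℝ satisfying q(x) ≤ C₁/(1 + |x + E|^{4/3}) for all x ∈ ℝ, and for every x ∈ ℝ, (Fu₁)(x) ≤ C·Δ·t^{−(2−s)}·u₁(x) + C·t^{2−s}·(u₂(x) + u₃(x)). -/

import Mathlib

open MeasureTheory Real

/-- The transfer operator `F` with parameters `s`, `t` and kernel density `q`: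
`(Fu)(x) = (t^{2−s}/|x|^{2−s}) ∫ q(−y − t²/x) u(y) dy` for `x ≠ 0`, and `(Fu)(0) = 0`. -/
noncomputable def Fop (s t : ℝ) (q u : ℝ → ℝ) : ℝ → ℝ := fun x =>
  if x = 0 then 0
  else (t ^ (2 - s) / |x| ^ (2 - s)) * ∫ y : ℝ, q (-y - t ^ 2 / x) * u y

/-- The weight function `w(x) = 1 + |x|^{2−s}`. -/
noncomputable def wfun (s x : ℝ) : ℝ := 1 + |x| ^ (2 - s)

/-- The weighted supremum norm `‖f‖ = sup_x |f(x)|·w(x)`. -/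
noncomputable def xnorm (s : ℝ) (f : ℝ → ℝ) : ℝ := ⨆ x : ℝ, |f x| * wfun s x

/-- `f : ℝ → ℝ` is a probability density. -/
def IsProbDensity (f : ℝ → ℝ) : Prop :=
  Measurable f ∧ (∀ x, 0 ≤ f x) ∧ (∫ x, f x) = 1

/-- The test function `u₁(x) = Δ⁻¹·1{|x| ≤ Δ}`. -/
noncomputable def testu1 (Δ : ℝ) : ℝ → ℝ := fun x => if |x| ≤ Δ then Δ⁻¹ else 0

/-- The test function `u₂(x) = |x|^{−(2−s)}·1{Δ ≤ |x| ≤ 1}`. -/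
noncomputable def testu2 (s Δ : ℝ) : ℝ → ℝ := fun x =>
  if Δ ≤ |x| ∧ |x| ≤ 1 then |x| ^ (-(2 - s)) else 0

/-- The test function `u₃(x) = |x|^{−(2−s)}·1{|x| ≥ 1}`. -/
noncomputable def testu3 (s : ℝ) : ℝ → ℝ := fun x =>
  if 1 ≤ |x| then |x| ^ (-(2 - s)) else 0

/-- A test function supported on `[-Δ, Δ]` only sees an upper bound of the kernel there. -/
lemma integral_mul_testu1_le {Δ B : ℝ} (hΔ : 0 < Δ) {p : ℝ → ℝ} (hp : ∀ y, 0 ≤ p y)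
    (hB : ∀ y, |y| ≤ Δ → p y ≤ B) : ∫ y, p y * testu1 Δ y ≤ 2 * B := by
  have hint : Integrable ((Set.Icc (-Δ) Δ).indicator fun _ : ℝ => B * Δ⁻¹) :=
    (integrableOn_const (by simp)).integrable_indicator measurableSet_Icc
  calc ∫ y, p y * testu1 Δ y
      ≤ ∫ y, (Set.Icc (-Δ) Δ).indicator (fun _ => B * Δ⁻¹) y := by
        refine integral_mono_of_nonneg (.of_forall fun y => ?_) hint (.of_forall fun y => ?_)
        · have := hp y
          simp only [testu1, Pi.zero_apply]
          split_ifs <;> positivity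
        · by_cases hy : |y| ≤ Δ
          · have hmem : y ∈ Set.Icc (-Δ) Δ := abs_le.mp hy
            simp only [testu1, if_pos hy, Set.indicator_of_mem hmem]
            gcongr
            exact hB y hy
          · have hmem : y ∉ Set.Icc (-Δ) Δ := fun h => hy (abs_le.mpr h)
            simp [testu1, if_neg hy, Set.indicator_of_notMem hmem]
    _ = 2 * B := by
        rw [integral_indicator measurableSet_Icc, setIntegral_const, Real.volume_real_Icc]
        rw [max_eq_left (by linarith), smul_eq_mul]
        field_simp
        ring

lemma rpow_le_sq_mul_one_add_rpow {r a w M : ℝ} (hr₀ : 0 ≤ r) (hr : r ≤ 4 / 3) (ha : 0 ≤ a)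
    (hw : 0 ≤ w) (hM : 1 ≤ M) (h : a ≤ w + (M - 1)) :
    a ^ r ≤ M ^ 2 * (1 + w ^ ((4 : ℝ) / 3)) := by
  have hmax : a ≤ M * max 1 w := by
    nlinarith [le_max_left 1 w, le_max_right 1 w]
  have h1 : (1 : ℝ) ≤ max 1 w := le_max_left 1 w
  calc a ^ r ≤ (M * max 1 w) ^ r := by gcongr
    _ = M ^ r * max 1 w ^ r := mul_rpow (by linarith) (by linarith)
    _ ≤ M ^ (2 : ℝ) * max 1 w ^ ((4 : ℝ) / 3) := by
        gcongr
        linarith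
    _ ≤ M ^ 2 * (1 + w ^ ((4 : ℝ) / 3)) := by
        rw [rpow_two]
        gcongr
        rcases max_cases 1 w with ⟨h, -⟩ | ⟨h, -⟩ <;> rw [h]
        · rw [one_rpow]
          linarith [rpow_nonneg hw ((4 : ℝ) / 3)]
        · linarith

lemma testu1_nonneg {Δ : ℝ} (hΔ : 0 ≤ Δ) (x : ℝ) : 0 ≤ testu1 Δ x := by
  unfold testu1
  split_ifs <;> positivity

lemma testu2_nonneg (s Δ x : ℝ) : 0 ≤ testu2 s Δ x := by
  unfold testu2
  split_ifs <;> positivity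

lemma testu3_nonneg (s x : ℝ) : 0 ≤ testu3 s x := by
  unfold testu3
  split_ifs <;> positivity

lemma rpow_neg_le_testu2_add_testu3 (s : ℝ) {Δ x : ℝ} (hx : Δ ≤ |x|) :
    |x| ^ (-(2 - s)) ≤ testu2 s Δ x + testu3 s x := by
  rcases le_total |x| 1 with h | h
  · have : testu2 s Δ x = |x| ^ (-(2 - s)) := if_pos ⟨hx, h⟩
    linarith [testu3_nonneg s x]
  · have : testu3 s x = |x| ^ (-(2 - s)) := if_pos h
    linarith [testu2_nonneg s Δ x]

/-- Fix `G > 0` and `C₁ > 0`.  There exist `α₀ > 0` and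
`C = C(G, C₁) > 0` such that for all `α ∈ (0, α₀]`, all `s ∈ (5/6, 1)`, all integers
`K ≥ 2`, all `g ∈ (0, G]`, and all `E ∈ [−G, G]`, with `t = g/(K log K)` and `Δ = t²/α`,
provided `Δ ≤ 1`: for every probability density `q` with
`q(x) ≤ C₁/(1 + |x + E|^{4/3})`, and for every `x`,
`(Fu₁)(x) ≤ C·Δ·t^{−(2−s)}·u₁(x) + C·t^{2−s}·(u₂(x) + u₃(x))`. -/
theorem stmt15 (G C₁ : ℝ) (hG : 0 < G) (hC₁ : 0 < C₁) :
    ∃ α₀ C : ℝ, 0 < α₀ ∧ 0 < C ∧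
      ∀ α ∈ Set.Ioc (0 : ℝ) α₀, ∀ s ∈ Set.Ioo (5 / 6 : ℝ) 1,
        ∀ K : ℕ, 2 ≤ K → ∀ g ∈ Set.Ioc (0 : ℝ) G, ∀ E ∈ Set.Icc (-G) G,
          ∀ t Δ : ℝ, t = g / (K * Real.log K) → Δ = t ^ 2 / α → Δ ≤ 1 →
            ∀ q : ℝ → ℝ, IsProbDensity q →
              (∀ x, q x ≤ C₁ / (1 + |x + E| ^ ((4 : ℝ) / 3))) →
              ∀ x : ℝ,
                Fop s t q (testu1 Δ) x ≤
                  C * Δ * t ^ (-(2 - s)) * testu1 Δ x +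
                    C * t ^ (2 - s) * (testu2 s Δ x + testu3 s x) := by
  refine ⟨1, 2 * C₁ * (G + 2) ^ 2, one_pos, by positivity, ?_⟩
  rintro α ⟨hα, -⟩ s ⟨hs₁, hs₂⟩ K hK g ⟨hg, -⟩ E ⟨hE₁, hE₂⟩ t Δ ht hΔ hΔ1 q ⟨-, hq0, -⟩ hq x
  have htpos : 0 < t := by
    have hK' : (1 : ℝ) < K := by exact_mod_cast hK
    have := Real.log_pos hK'
    rw [ht]
    positivity
  have hΔpos : 0 < Δ := by
    rw [hΔ]
    positivity
  have hu1 := testu1_nonneg hΔpos.le x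
  have hu2 := testu2_nonneg s Δ x
  have hu3 := testu3_nonneg s x
  rcases eq_or_ne x 0 with rfl | hx
  · simp only [Fop, if_true]
    positivity
  have hxpos : 0 < |x| := abs_pos.mpr hx
  simp only [Fop, if_neg hx]
  rcases le_or_gt Δ |x| with hxΔ | hxΔ
  · have hqC (y : ℝ) : q y ≤ C₁ := (hq y).trans <|
      div_le_self hC₁.le (by linarith [rpow_nonneg (abs_nonneg (y + E)) ((4 : ℝ) / 3)])
    have hI := integral_mul_testu1_le hΔpos (p := fun y => q (-y - t ^ 2 / x))
      (fun y => hq0 _) (fun y _ => hqC _)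
    have hM : 2 * C₁ ≤ 2 * C₁ * (G + 2) ^ 2 := le_mul_of_one_le_right (by positivity) (by nlinarith)
    calc t ^ (2 - s) / |x| ^ (2 - s) * ∫ y, q (-y - t ^ 2 / x) * testu1 Δ y
        ≤ t ^ (2 - s) / |x| ^ (2 - s) * (2 * C₁ * (G + 2) ^ 2) := by
          gcongr
          exact hI.trans hM
      _ = 2 * C₁ * (G + 2) ^ 2 * t ^ (2 - s) * |x| ^ (-(2 - s)) := by
          rw [rpow_neg hxpos.le]
          ring
      _ ≤ 2 * C₁ * (G + 2) ^ 2 * t ^ (2 - s) * (testu2 s Δ x + testu3 s x) := by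
          gcongr
          exact rpow_neg_le_testu2_add_testu3 s hxΔ
      _ ≤ _ := le_add_of_nonneg_left (by positivity)
  · have hz : 0 < |t ^ 2 / x| := by positivity
    have hqB (y : ℝ) (hy : |y| ≤ Δ) :
        q (-y - t ^ 2 / x) ≤ C₁ * (G + 2) ^ 2 / |t ^ 2 / x| ^ (2 - s) := by
      have hE : |E| ≤ G := abs_le.mpr ⟨hE₁, hE₂⟩
      have htri : |t ^ 2 / x| ≤ |-y - t ^ 2 / x + E| + (G + 2 - 1) := by
        have h1 := abs_sub (E - y) (-y - t ^ 2 / x + E)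
        have h2 := abs_sub E y
        rw [show E - y - (-y - t ^ 2 / x + E) = t ^ 2 / x by ring] at h1
        linarith
      have h := rpow_le_sq_mul_one_add_rpow (r := 2 - s) (by linarith) (by linarith)
        (abs_nonneg _) (abs_nonneg _) (by linarith) htri
      refine (hq _).trans ?_
      rw [div_le_div_iff₀ (by positivity) (by positivity), mul_assoc]
      gcongr
    have hI := integral_mul_testu1_le hΔpos (p := fun y => q (-y - t ^ 2 / x))
      (fun y => hq0 _) hqB
    have hu : testu1 Δ x = Δ⁻¹ := if_pos hxΔ.le
    calc t ^ (2 - s) / |x| ^ (2 - s) * ∫ y, q (-y - t ^ 2 / x) * testu1 Δ y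
        ≤ t ^ (2 - s) / |x| ^ (2 - s) * (2 * (C₁ * (G + 2) ^ 2 / |t ^ 2 / x| ^ (2 - s))) := by
          gcongr
      _ = 2 * C₁ * (G + 2) ^ 2 * Δ * t ^ (-(2 - s)) * testu1 Δ x := by
          rw [hu, rpow_neg htpos.le, abs_div, abs_of_pos (pow_pos htpos 2),
            div_rpow (by positivity) hxpos.le, sq t, mul_rpow htpos.le htpos.le]
          have := rpow_pos_of_pos htpos (2 - s)
          have := rpow_pos_of_pos hxpos (2 - s)
          field_simp
      _ ≤ _ := le_add_of_nonneg_right (by positivity)
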